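/- (Accelerated RSD, strongly convex case.) Under the accelerated RSD setting — A x^0 = b, v^0 = x^0, M symmetric positive semidefinite and positive definite on ker(A), f differentiable with f(y) ≤ f(x) + ⟨∇f(x), y−x⟩ + ½(y−x)^T M(y−x) on x^0 + ker(A) and satisfying f(x) ≥ f(y) + ⟨∇f(y), x−y⟩ + (σ_Z/2)(x−y)^T Z†(x−y) on x^0 + ker(A) with σ_Z > 0, S^k i.i.d. from a finite distribution with Z = Σ_i P_i Z_{S_i} positive definite on ker(A), ν ≥ ν_max — choose γ_k = 1/√(σ_Z ν), α_k = γ_k σ_Z/(1 + γ_k σ_Z), β_k = 1 − γ_k σ_Z, and iterate y^k = α_k v^k + (1−α_k) x^k, x^{k+1} = y^k − Z_{S^k} ∇f(y^k), v^{k+1} = β_k v^k + (1−β_k) y^k − γ_k Z_{S^k} ∇f(y^k). Then for every minimizer x* of f over {x : Ax = b} with optimal value f* and every k ≥ 0, E[ (v^k − x*)^T Z† (v^k − x*) + (2/σ_Z)(f(x^k) − f*) ] ≤ (1 − √(σ_Z/ν))^k [ (x^0 − x*)^T Z† (x^0 − x*) + (2/σ_Z)(f(x^0) − f*) ]. -/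

import Mathlib

open Matrix

-- The Moore–Penrose pseudoinverse of a real matrix, defined via the four
-- Penrose conditions (which have a unique solution for every real matrix).
open Classical in
noncomputable def mpinv {k l : Type*} [Fintype k] [Fintype l] (B : Matrix k l ℝ) :
    Matrix l k ℝ :=
  if h : ∃ X : Matrix l k ℝ,
      B * X * B = B ∧ X * B * X = X ∧ (B * X)ᵀ = B * X ∧ (X * B)ᵀ = X * B
  then h.choose else 0

/-- `P_S = I - (AS)†(AS)`, the orthogonal projection onto `ker(AS)`. -/
noncomputable def Pmat {m n p : ℕ} (A : Matrix (Fin m) (Fin n) ℝ)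
    (S : Matrix (Fin n) (Fin p) ℝ) : Matrix (Fin p) (Fin p) ℝ :=
  1 - mpinv (A * S) * (A * S)

/-- `Z_S = S P_S (P_Sᵀ Sᵀ M S P_S)† P_Sᵀ Sᵀ`. -/
noncomputable def Zmat {m n p : ℕ} (A : Matrix (Fin m) (Fin n) ℝ)
    (M : Matrix (Fin n) (Fin n) ℝ) (S : Matrix (Fin n) (Fin p) ℝ) :
    Matrix (Fin n) (Fin n) ℝ :=
  S * Pmat A S * mpinv ((Pmat A S)ᵀ * Sᵀ * M * S * Pmat A S) * (Pmat A S)ᵀ * Sᵀ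

/-- The gradient of `f : ℝ^n → ℝ`, as a vector of partial derivatives. -/
noncomputable def gradv {n : ℕ} (f : (Fin n → ℝ) → ℝ) (x : Fin n → ℝ) : Fin n → ℝ :=
  fun i => fderiv ℝ f x (Pi.single i 1)

/-- `X` satisfies the four Penrose conditions for `B`. -/
def IsPenrose {k l : Type*} [Fintype k] [Fintype l] (B : Matrix k l ℝ) (X : Matrix l k ℝ) : Prop :=
  B * X * B = B ∧ X * B * X = X ∧ (B * X)ᵀ = B * X ∧ (X * B)ᵀ = X * B

theorem IsPenrose.unique {k l : Type*} [Fintype k] [Fintype l] {B : Matrix k l ℝ}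
    {X Y : Matrix l k ℝ} (hX : IsPenrose B X) (hY : IsPenrose B Y) : X = Y := by
  obtain ⟨x1, x2, x3, x4⟩ := hX
  obtain ⟨y1, y2, y3, y4⟩ := hY
  have hBX : B * X = B * Y := by
    calc B * X = (B * X)ᵀ := x3.symm
      _ = (B * Y * (B * X))ᵀ := by rw [← Matrix.mul_assoc, y1]
      _ = B * X * (B * Y) := by rw [transpose_mul, x3, y3]
      _ = B * Y := by rw [← Matrix.mul_assoc, x1]
  have hXB : X * B = Y * B := by
    calc X * B = (X * B)ᵀ := x4.symm
      _ = (X * B * (Y * B))ᵀ := by rw [Matrix.mul_assoc, ← Matrix.mul_assoc B, y1]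
      _ = Y * B * (X * B) := by rw [transpose_mul, x4, y4]
      _ = Y * B := by rw [Matrix.mul_assoc, ← Matrix.mul_assoc B, x1]
  calc X = X * B * X := x2.symm
    _ = Y * (B * X) := by rw [hXB, Matrix.mul_assoc]
    _ = Y := by rw [hBX, ← Matrix.mul_assoc, y2]

theorem exists_isPenrose_of_isHermitian {k : Type*} [Fintype k] {B : Matrix k k ℝ}
    (hB : B.IsHermitian) : ∃ X, IsPenrose B X := by
  classical
  set φ := Unitary.conjStarAlgAut ℝ _ hB.eigenvectorUnitary
  set d : k → ℝ := RCLike.ofReal ∘ hB.eigenvalues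
  have hφ : B = φ (diagonal d) := hB.spectral_theorem
  have hT : ∀ e : k → ℝ, (φ (diagonal e))ᵀ = φ (diagonal e) := fun e => by
    rw [← conjTranspose_eq_transpose_of_trivial, ← star_eq_conjTranspose, ← map_star,
      star_eq_conjTranspose, diagonal_conjTranspose, star_trivial]
  refine ⟨φ (diagonal d⁻¹), ?_, ?_, ?_, ?_⟩ <;> rw [hφ] <;>
    simp only [← map_mul, diagonal_mul_diagonal, hT, Pi.inv_apply]
  · congr 2; ext i; exact mul_inv_mul_cancel _
  · congr 2; ext i; simpa using mul_inv_mul_cancel (d i)⁻¹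

theorem exists_isPenrose {k l : Type*} [Fintype k] [Fintype l] (B : Matrix k l ℝ) :
    ∃ X, IsPenrose B X := by
  obtain ⟨G, g1, g2, g3, g4⟩ :=
    exists_isPenrose_of_isHermitian (isHermitian_conjTranspose_mul_self B)
  rw [conjTranspose_eq_transpose_of_trivial] at *
  have hsymm : (Bᵀ * B)ᵀ = Bᵀ * B := by rw [transpose_mul, transpose_transpose]
  have hG : Gᵀ = G := by
    refine IsPenrose.unique (B := Bᵀ * B) ⟨?_, ?_, ?_, ?_⟩ ⟨g1, g2, g3, g4⟩
    · simpa [hsymm, Matrix.mul_assoc] using congrArg transpose g1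
    · simpa [hsymm, Matrix.mul_assoc] using congrArg transpose g2
    · rw [← hsymm, ← transpose_mul, g4, g4]
    · rw [← hsymm, ← transpose_mul, g3, g3]
  have hBGB : B * (G * (Bᵀ * B)) = B := by
    rw [← sub_eq_zero, ← conjTranspose_mul_self_eq_zero, conjTranspose_eq_transpose_of_trivial]
    have hE : Bᵀ * (B * (G * (Bᵀ * B)) - B) = 0 := by
      rw [Matrix.mul_sub, sub_eq_zero]
      simpa only [Matrix.mul_assoc] using g1
    rw [transpose_sub, Matrix.sub_mul, hE, transpose_mul, Matrix.mul_assoc, hE, Matrix.mul_zero,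
      sub_zero]
  refine ⟨G * Bᵀ, ?_, ?_, ?_, ?_⟩
  · simpa only [Matrix.mul_assoc] using hBGB
  · simpa only [Matrix.mul_assoc] using congrArg (· * Bᵀ) g2
  · simp [transpose_mul, hG, Matrix.mul_assoc]
  · simpa only [Matrix.mul_assoc] using g4

theorem isPenrose_mpinv {k l : Type*} [Fintype k] [Fintype l] (B : Matrix k l ℝ) :
    IsPenrose B (mpinv B) := by
  have h : ∃ X : Matrix l k ℝ,
      B * X * B = B ∧ X * B * X = X ∧ (B * X)ᵀ = B * X ∧ (X * B)ᵀ = X * B := exists_isPenrose B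
  rw [mpinv, dif_pos h]
  exact h.choose_spec

theorem mpinv_transpose_eq_self {k : Type*} [Fintype k] {B : Matrix k k ℝ} (hB : Bᵀ = B) :
    (mpinv B)ᵀ = mpinv B := by
  obtain ⟨h1, h2, h3, h4⟩ := isPenrose_mpinv B
  refine IsPenrose.unique (B := B) ⟨?_, ?_, ?_, ?_⟩ ⟨h1, h2, h3, h4⟩
  · simpa [hB, Matrix.mul_assoc] using congrArg transpose h1
  · simpa [hB, Matrix.mul_assoc] using congrArg transpose h2
  · rw [← hB, ← transpose_mul, hB, h4, h4]
  · rw [← hB, ← transpose_mul, hB, h3, h3]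

section Sketch

variable {m n p : ℕ} (A : Matrix (Fin m) (Fin n) ℝ) {M : Matrix (Fin n) (Fin n) ℝ}
  (S : Matrix (Fin n) (Fin p) ℝ)

theorem mul_Zmat_eq_zero : A * Zmat A M S = 0 := by
  have h : A * (S * Pmat A S) = 0 := by
    rw [Pmat, ← Matrix.mul_assoc, Matrix.mul_sub, Matrix.mul_one, ← Matrix.mul_assoc,
      (isPenrose_mpinv (A * S)).1, sub_self]
  simp only [Zmat, ← Matrix.mul_assoc] at h ⊢
  simp [h]

theorem Zmat_eq (M : Matrix (Fin n) (Fin n) ℝ) :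
    Zmat A M S = S * Pmat A S * mpinv ((S * Pmat A S)ᵀ * M * (S * Pmat A S)) * (S * Pmat A S)ᵀ := by
  simp only [Zmat, transpose_mul, Matrix.mul_assoc]

theorem Zmat_transpose (hM : Mᵀ = M) : (Zmat A M S)ᵀ = Zmat A M S := by
  rw [Zmat_eq]
  generalize S * Pmat A S = Q
  have hK : (Qᵀ * M * Q)ᵀ = Qᵀ * M * Q := by
    simp [transpose_mul, hM, Matrix.mul_assoc]
  rw [transpose_mul, transpose_mul, mpinv_transpose_eq_self hK, transpose_transpose,
    ← Matrix.mul_assoc Q]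

theorem Zmat_mul_mul_Zmat : Zmat A M S * M * Zmat A M S = Zmat A M S := by
  rw [Zmat_eq]
  set Q := S * Pmat A S
  have h := (isPenrose_mpinv (Qᵀ * M * Q)).2.1
  calc _ = Q * (mpinv (Qᵀ * M * Q) * (Qᵀ * M * Q) * mpinv (Qᵀ * M * Q)) * Qᵀ := by
        simp only [Matrix.mul_assoc]
    _ = _ := by rw [h]

theorem Zmat_posSemidef (hM : M.PosSemidef) : (Zmat A M S).PosSemidef := by
  have hMt : Mᵀ = M := by simpa using hM.isHermitian.eq
  have := hM.conjTranspose_mul_mul_same (Zmat A M S)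
  rwa [conjTranspose_eq_transpose_of_trivial, Zmat_transpose A S hMt, Zmat_mul_mul_Zmat] at this

end Sketch

section PinvOnKernel

variable {m n : ℕ} {A : Matrix (Fin m) (Fin n) ℝ} {Z : Matrix (Fin n) (Fin n) ℝ}

theorem mpinv_posSemidef (hZ : Z.PosSemidef) : (mpinv Z).PosSemidef := by
  have hZt : Zᵀ = Z := by simpa using hZ.isHermitian.eq
  have := hZ.conjTranspose_mul_mul_same (mpinv Z)
  rwa [conjTranspose_eq_transpose_of_trivial, mpinv_transpose_eq_self hZt,
    (isPenrose_mpinv Z).2.1] at this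

theorem mul_mpinv_mul_eq_zero (hZ : Zᵀ = Z) (hAZ : A * Z = 0) : A * (mpinv Z * Z) = 0 := by
  rw [← (isPenrose_mpinv Z).2.2.2, transpose_mul, hZ, ← Matrix.mul_assoc, hAZ, Matrix.zero_mul]

theorem mpinv_mul_mulVec_of_mem_ker (hZ : Zᵀ = Z) (hAZ : A * Z = 0)
    (hpd : ∀ u, A *ᵥ u = 0 → u ≠ 0 → 0 < u ⬝ᵥ Z *ᵥ u) {w : Fin n → ℝ} (hw : A *ᵥ w = 0) :
    (mpinv Z * Z) *ᵥ w = w := by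
  by_contra hne
  have hker : A *ᵥ ((mpinv Z * Z) *ᵥ w - w) = 0 := by
    rw [mulVec_sub, mulVec_mulVec, mul_mpinv_mul_eq_zero hZ hAZ, hw, zero_mulVec, sub_self]
  have h := hpd _ hker (sub_ne_zero.2 hne)
  rw [mulVec_sub Z, mulVec_mulVec, ← Matrix.mul_assoc, (isPenrose_mpinv Z).1, sub_self,
    dotProduct_zero] at h
  exact lt_irrefl _ h

theorem dotProduct_mpinv_mulVec (hZ : Zᵀ = Z) (hAZ : A * Z = 0)
    (hpd : ∀ u, A *ᵥ u = 0 → u ≠ 0 → 0 < u ⬝ᵥ Z *ᵥ u) {w : Fin n → ℝ} (hw : A *ᵥ w = 0)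
    (u : Fin n → ℝ) : w ⬝ᵥ mpinv Z *ᵥ (Z *ᵥ u) = w ⬝ᵥ u := by
  rw [mulVec_mulVec, dotProduct_mulVec, ← mulVec_transpose, (isPenrose_mpinv Z).2.2.2,
    mpinv_mul_mulVec_of_mem_ker hZ hAZ hpd hw]

theorem mul_mpinv_mul_of_mul_eq_zero (hZ : Zᵀ = Z) (hAZ : A * Z = 0)
    (hpd : ∀ u, A *ᵥ u = 0 → u ≠ 0 → 0 < u ⬝ᵥ Z *ᵥ u) {G : Matrix (Fin n) (Fin n) ℝ}
    (hG : Gᵀ = G) (hAG : A * G = 0) : G * (mpinv Z * Z) = G := by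
  have h : mpinv Z * Z * G = G := by
    refine ext_of_mulVec_single fun i => ?_
    rw [← mulVec_mulVec]
    refine mpinv_mul_mulVec_of_mem_ker hZ hAZ hpd ?_
    rw [mulVec_mulVec, hAG, zero_mulVec]
  have := congrArg transpose h
  rwa [transpose_mul, (isPenrose_mpinv Z).2.2.2, hG] at this

end PinvOnKernel

section QuadraticForm

variable {n : ℕ} {W : Matrix (Fin n) (Fin n) ℝ}

theorem dotProduct_mulVec_comm_of_transpose_eq (hW : Wᵀ = W) (a b : Fin n → ℝ) :
    a ⬝ᵥ W *ᵥ b = b ⬝ᵥ W *ᵥ a := by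
  rw [dotProduct_mulVec, ← mulVec_transpose, hW, dotProduct_comm]

theorem dotProduct_mulVec_sub_smul (hW : Wᵀ = W) (a b : Fin n → ℝ) (c : ℝ) :
    (a - c • b) ⬝ᵥ W *ᵥ (a - c • b) =
      a ⬝ᵥ W *ᵥ a - 2 * c * (a ⬝ᵥ W *ᵥ b) + c ^ 2 * (b ⬝ᵥ W *ᵥ b) := by
  simp only [mulVec_sub, mulVec_smul, dotProduct_sub, sub_dotProduct, dotProduct_smul,
    smul_dotProduct, smul_eq_mul, dotProduct_mulVec_comm_of_transpose_eq hW b a]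
  ring

theorem dotProduct_mulVec_convexComb_le (hW : Wᵀ = W) (hWpos : ∀ a, 0 ≤ a ⬝ᵥ W *ᵥ a)
    (a b : Fin n → ℝ) {c : ℝ} (h0 : 0 ≤ c) (h1 : c ≤ 1) :
    (c • a + (1 - c) • b) ⬝ᵥ W *ᵥ (c • a + (1 - c) • b) ≤
      c * (a ⬝ᵥ W *ᵥ a) + (1 - c) * (b ⬝ᵥ W *ᵥ b) := by
  have h := mul_nonneg (mul_nonneg h0 (sub_nonneg.2 h1)) (hWpos (a - b))
  simp only [mulVec_add, mulVec_sub, mulVec_smul, dotProduct_add, add_dotProduct, dotProduct_sub,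
    sub_dotProduct, dotProduct_smul, smul_dotProduct, smul_eq_mul,
    dotProduct_mulVec_comm_of_transpose_eq hW b a] at h ⊢
  linarith

theorem dotProduct_sum_smul_mulVec {N : ℕ} (P : Fin N → ℝ) (G : Fin N → Matrix (Fin n) (Fin n) ℝ)
    (a u : Fin n → ℝ) : a ⬝ᵥ (∑ i, P i • G i) *ᵥ u = ∑ i, P i * (a ⬝ᵥ G i *ᵥ u) := by
  simp only [sum_mulVec, dotProduct_sum, smul_mulVec, dotProduct_smul, smul_eq_mul]

theorem dotProduct_mulVec_sum_smul_mulVec {N : ℕ} (P : Fin N → ℝ)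
    (G : Fin N → Matrix (Fin n) (Fin n) ℝ) (a u : Fin n → ℝ) :
    a ⬝ᵥ W *ᵥ ((∑ i, P i • G i) *ᵥ u) = ∑ i, P i * (a ⬝ᵥ W *ᵥ (G i *ᵥ u)) := by
  simp only [sum_mulVec, mulVec_sum, dotProduct_sum, smul_mulVec, mulVec_smul, dotProduct_smul,
    smul_eq_mul]

/-- Jensen's inequality for the quadratic form of a positive semidefinite matrix. -/
theorem dotProduct_mulVec_sum_le (hW : Wᵀ = W) (hWpos : ∀ a, 0 ≤ a ⬝ᵥ W *ᵥ a) {N : ℕ}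
    {P : Fin N → ℝ} (hP : ∀ i, 0 ≤ P i) (hPsum : ∑ i, P i = 1)
    (G : Fin N → Matrix (Fin n) (Fin n) ℝ) (u : Fin n → ℝ) :
    ((∑ i, P i • G i) *ᵥ u) ⬝ᵥ W *ᵥ ((∑ i, P i • G i) *ᵥ u) ≤
      ∑ i, P i * ((G i *ᵥ u) ⬝ᵥ W *ᵥ (G i *ᵥ u)) := by
  have hlin := dotProduct_mulVec_sum_smul_mulVec (W := W) P G ((∑ i, P i • G i) *ᵥ u) u
  set z := (∑ i, P i • G i) *ᵥ u
  have hsum : 0 ≤ ∑ i, P i * ((z - (1 : ℝ) • (G i *ᵥ u)) ⬝ᵥ W *ᵥ (z - (1 : ℝ) • (G i *ᵥ u))) :=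
    Finset.sum_nonneg fun i _ => mul_nonneg (hP i) (hWpos _)
  have hexp : ∑ i, P i * ((z - (1 : ℝ) • (G i *ᵥ u)) ⬝ᵥ W *ᵥ (z - (1 : ℝ) • (G i *ᵥ u))) =
      (∑ i, P i) * (z ⬝ᵥ W *ᵥ z) - 2 * ∑ i, P i * (z ⬝ᵥ W *ᵥ (G i *ᵥ u)) +
        ∑ i, P i * ((G i *ᵥ u) ⬝ᵥ W *ᵥ (G i *ᵥ u)) := by
    rw [Finset.sum_mul, Finset.mul_sum, ← Finset.sum_sub_distrib, ← Finset.sum_add_distrib]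
    refine Finset.sum_congr rfl fun i _ => ?_
    rw [dotProduct_mulVec_sub_smul hW]
    ring
  rw [hexp, hPsum, ← hlin] at hsum
  linarith

end QuadraticForm

section SketchDescent

variable {m n N : ℕ} {A : Matrix (Fin m) (Fin n) ℝ} {b : Fin m → ℝ}
  {M Z W : Matrix (Fin n) (Fin n) ℝ} {f : (Fin n → ℝ) → ℝ}
  {G : Fin N → Matrix (Fin n) (Fin n) ℝ} {P : Fin N → ℝ} {σ ν : ℝ}

theorem mulVec_dotProduct_mulVec_mulVec {H : Matrix (Fin n) (Fin n) ℝ} (hH : Hᵀ = H)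
    (hHM : H * M * H = H) (g : Fin n → ℝ) : (H *ᵥ g) ⬝ᵥ M *ᵥ (H *ᵥ g) = g ⬝ᵥ H *ᵥ g := by
  conv_rhs => rw [← hHM]
  rw [← mulVec_mulVec, ← mulVec_mulVec, dotProduct_mulVec g, ← mulVec_transpose, hH]

theorem sketch_descent {H : Matrix (Fin n) (Fin n) ℝ} (hH : Hᵀ = H) (hHM : H * M * H = H)
    (hAH : A * H = 0)
    (hsmooth : ∀ x y : Fin n → ℝ, A *ᵥ x = b → A *ᵥ y = b →
      f y ≤ f x + gradv f x ⬝ᵥ (y - x) + (1 / 2) * ((y - x) ⬝ᵥ M *ᵥ (y - x)))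
    {y : Fin n → ℝ} (hy : A *ᵥ y = b) :
    f (y - H *ᵥ gradv f y) ≤ f y - (1 / 2) * (gradv f y ⬝ᵥ H *ᵥ gradv f y) := by
  have h := hsmooth y (y - H *ᵥ gradv f y) hy
    (by rw [mulVec_sub, mulVec_mulVec, hAH, zero_mulVec, sub_zero, hy])
  have hd : y - H *ᵥ gradv f y - y = -(H *ᵥ gradv f y) := by abel
  rw [hd, mulVec_neg, dotProduct_neg, neg_dotProduct, dotProduct_neg, neg_neg,
    mulVec_dotProduct_mulVec_mulVec hH hHM] at h
  linarith

/-- One step of the accelerated method contracts the expected Lyapunov function. -/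
theorem accelerated_step_le (hG : ∀ i, (G i)ᵀ = G i) (hGM : ∀ i, G i * M * G i = G i)
    (hAG : ∀ i, A * G i = 0)
    (hsmooth : ∀ x y : Fin n → ℝ, A *ᵥ x = b → A *ᵥ y = b →
      f y ≤ f x + gradv f x ⬝ᵥ (y - x) + (1 / 2) * ((y - x) ⬝ᵥ M *ᵥ (y - x)))
    (hP : ∀ i, 0 ≤ P i) (hPsum : ∑ i, P i = 1) (hZ : Z = ∑ i, P i • G i)
    (hW : Wᵀ = W) (hWpos : ∀ a, 0 ≤ a ⬝ᵥ W *ᵥ a)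
    (hWZ : ∀ w, A *ᵥ w = 0 → ∀ u, w ⬝ᵥ W *ᵥ (Z *ᵥ u) = w ⬝ᵥ u) (hσ : 0 < σ)
    (hsc : ∀ x y : Fin n → ℝ, A *ᵥ x = b → A *ᵥ y = b →
      f x ≥ f y + gradv f y ⬝ᵥ (x - y) + (σ / 2) * ((x - y) ⬝ᵥ W *ᵥ (x - y)))
    (hν : ∀ g, ∑ i, P i * ((G i *ᵥ g) ⬝ᵥ W *ᵥ (G i *ᵥ g)) ≤ ν * (g ⬝ᵥ Z *ᵥ g))
    {γ α β : ℝ} (hγ0 : 0 < γ) (hγ : γ ^ 2 * ν = 1 / σ) (hα : α = γ * σ / (1 + γ * σ))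
    (hβ : β = 1 - γ * σ) (hβ0 : 0 ≤ β) {x v y xs : Fin n → ℝ} (hx : A *ᵥ x = b)
    (hv : A *ᵥ v = b) (hxs : A *ᵥ xs = b) (hy : y = α • v + (1 - α) • x) :
    ∑ i, P i * ((β • v + (1 - β) • y - γ • (G i *ᵥ gradv f y) - xs) ⬝ᵥ
        W *ᵥ (β • v + (1 - β) • y - γ • (G i *ᵥ gradv f y) - xs) +
          2 / σ * (f (y - G i *ᵥ gradv f y) - f xs)) ≤
      β * ((v - xs) ⬝ᵥ W *ᵥ (v - xs) + 2 / σ * (f x - f xs)) := by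
  have hyb : A *ᵥ y = b := by
    rw [hy, mulVec_add, mulVec_smul, mulVec_smul, hx, hv, ← add_smul, add_sub_cancel, one_smul]
  set g := gradv f y with hg
  set d := β • (v - xs) + (1 - β) • (y - xs) with hd
  have hdker : A *ᵥ d = 0 := by
    simp [hd, mulVec_add, mulVec_smul, mulVec_sub, hv, hyb, hxs]
  have hterm : ∀ i, P i * ((β • v + (1 - β) • y - γ • (G i *ᵥ g) - xs) ⬝ᵥ
        W *ᵥ (β • v + (1 - β) • y - γ • (G i *ᵥ g) - xs) +
          2 / σ * (f (y - G i *ᵥ g) - f xs)) ≤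
      P i * (d ⬝ᵥ W *ᵥ d + 2 / σ * (f y - f xs)) - 2 * γ * (P i * (d ⬝ᵥ W *ᵥ (G i *ᵥ g))) +
        γ ^ 2 * (P i * ((G i *ᵥ g) ⬝ᵥ W *ᵥ (G i *ᵥ g))) - 1 / σ * (P i * (g ⬝ᵥ G i *ᵥ g)) := by
    intro i
    have he : β • v + (1 - β) • y - γ • (G i *ᵥ g) - xs = d - γ • (G i *ᵥ g) := by
      rw [hd]; module
    have hdesc := sketch_descent (hG i) (hGM i) (hAG i) hsmooth hyb
    rw [← hg] at hdesc
    have h2 := mul_le_mul_of_nonneg_left hdesc (by positivity : 0 ≤ 2 / σ)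
    rw [he, dotProduct_mulVec_sub_smul hW]
    refine (mul_le_mul_of_nonneg_left (c := d ⬝ᵥ W *ᵥ d - 2 * γ * (d ⬝ᵥ W *ᵥ (G i *ᵥ g)) +
      γ ^ 2 * ((G i *ᵥ g) ⬝ᵥ W *ᵥ (G i *ᵥ g)) +
      (2 / σ * (f y - 1 / 2 * (g ⬝ᵥ G i *ᵥ g)) - 2 / σ * f xs)) (by linarith) (hP i)).trans_eq ?_
    ring
  refine (Finset.sum_le_sum fun i _ => hterm i).trans ?_
  rw [Finset.sum_sub_distrib, Finset.sum_add_distrib, Finset.sum_sub_distrib, ← Finset.sum_mul,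
    ← Finset.mul_sum, ← Finset.mul_sum, ← Finset.mul_sum, hPsum,
    ← dotProduct_mulVec_sum_smul_mulVec, ← dotProduct_sum_smul_mulVec, ← hZ, hWZ d hdker]
  have hνg := mul_le_mul_of_nonneg_left (hν g) (sq_nonneg γ)
  rw [← mul_assoc, hγ] at hνg
  have hconv := dotProduct_mulVec_convexComb_le hW hWpos (v - xs) (y - xs) hβ0
    (by rw [hβ]; nlinarith)
  rw [← hd] at hconv
  have hdg : d ⬝ᵥ g = -(g ⬝ᵥ (xs - y)) - β / (γ * σ) * (g ⬝ᵥ (x - y)) := by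
    have hvy : d = -(xs - y) - (β / (γ * σ)) • (x - y) := by
      have h1 : (1 + γ * σ) ≠ 0 := by positivity
      have hxy : (γ * σ) • (v - y) = -(x - y) := by
        have : γ * σ * (1 - α) = α := by rw [hα]; field_simp; ring
        have h2 : (γ * σ) • (v - y) = (γ * σ * (1 - α)) • (v - x) := by rw [hy]; module
        rw [h2, this, hy]; module
      have h3 : -(x - y) = (γ * σ) • (v - y) := hxy.symm
      have h4 : -((β / (γ * σ)) • (x - y)) = β • (v - y) := by
        rw [← smul_neg, h3, smul_smul, div_mul_cancel₀ _ (by positivity)]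
      rw [sub_eq_add_neg, h4, hd]; module
    rw [hvy, dotProduct_comm, dotProduct_sub, dotProduct_neg, dotProduct_smul, smul_eq_mul]
  have hs1 := mul_le_mul_of_nonneg_left (hsc xs y hxs hyb) (by positivity : 0 ≤ 2 * γ)
  have hs2 : f y + g ⬝ᵥ (x - y) ≤ f x := by
    have := hsc x y hx hyb
    have h0 := mul_nonneg (half_pos hσ).le (hWpos (x - y))
    linarith
  have hs3 := mul_le_mul_of_nonneg_left hs2 (by positivity : 0 ≤ 2 * β / σ)
  have hsymm : (xs - y) ⬝ᵥ W *ᵥ (xs - y) = (y - xs) ⬝ᵥ W *ᵥ (y - xs) := by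
    rw [← neg_sub y xs, mulVec_neg, dotProduct_neg, neg_dotProduct, neg_neg]
  rw [hsymm] at hs1
  rw [hdg]
  have hcoef : 2 * γ * (β / (γ * σ)) = 2 * β / σ := by field_simp
  have hγσ : 2 * γ = 2 / σ - 2 * β / σ := by rw [hβ]; field_simp; ring
  have hb : γ * σ = 1 - β := by rw [hβ]; ring
  have e1 : 2 * γ * (-(g ⬝ᵥ (xs - y)) - β / (γ * σ) * (g ⬝ᵥ (x - y))) =
      -(2 * γ * (g ⬝ᵥ (xs - y))) - 2 * β / σ * (g ⬝ᵥ (x - y)) := by rw [← hcoef]; ring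
  have e2 : 2 * γ * (f y + g ⬝ᵥ (xs - y) + σ / 2 * ((y - xs) ⬝ᵥ W *ᵥ (y - xs))) =
      (2 / σ - 2 * β / σ) * f y + 2 * γ * (g ⬝ᵥ (xs - y)) +
        (1 - β) * ((y - xs) ⬝ᵥ W *ᵥ (y - xs)) := by rw [← hγσ, ← hb]; ring
  have e3 : 2 * γ * f xs = (2 / σ - 2 * β / σ) * f xs := by rw [hγσ]
  rw [← hg, e2, e3] at hs1
  rw [e1]
  have e4 : β * (2 / σ * (f x - f xs)) = 2 * β / σ * (f x - f xs) := by ring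
  rw [mul_add β, e4]
  linarith

/-- If `ker A` is nontrivial, then the strong convexity constant is at most `ν`. -/
theorem strongConvexity_le_of_ker_ne_bot (hG : ∀ i, (G i)ᵀ = G i)
    (hGM : ∀ i, G i * M * G i = G i) (hAG : ∀ i, A * G i = 0)
    (hsmooth : ∀ x y : Fin n → ℝ, A *ᵥ x = b → A *ᵥ y = b →
      f y ≤ f x + gradv f x ⬝ᵥ (y - x) + (1 / 2) * ((y - x) ⬝ᵥ M *ᵥ (y - x)))
    (hP : ∀ i, 0 ≤ P i) (hPsum : ∑ i, P i = 1) (hZ : Z = ∑ i, P i • G i)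
    (hW : Wᵀ = W) (hWpos : ∀ a, 0 ≤ a ⬝ᵥ W *ᵥ a)
    (hAZ : A * Z = 0) (hWZ : ∀ w, A *ᵥ w = 0 → ∀ u, w ⬝ᵥ W *ᵥ (Z *ᵥ u) = w ⬝ᵥ u) (hσ : 0 < σ)
    (hsc : ∀ x y : Fin n → ℝ, A *ᵥ x = b → A *ᵥ y = b →
      f x ≥ f y + gradv f y ⬝ᵥ (x - y) + (σ / 2) * ((x - y) ⬝ᵥ W *ᵥ (x - y)))
    (hν : ∀ g, ∑ i, P i * ((G i *ᵥ g) ⬝ᵥ W *ᵥ (G i *ᵥ g)) ≤ ν * (g ⬝ᵥ Z *ᵥ g))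
    {x₀ : Fin n → ℝ} (hx₀ : A *ᵥ x₀ = b) {u : Fin n → ℝ} (hu : 0 < u ⬝ᵥ Z *ᵥ u) : σ ≤ ν := by
  have hquad : ∀ d, A *ᵥ d = 0 → σ * (d ⬝ᵥ W *ᵥ d) ≤ d ⬝ᵥ M *ᵥ d := by
    intro d hd
    have hxd : A *ᵥ (x₀ + d) = b := by rw [mulVec_add, hx₀, hd, add_zero]
    have h1 := hsmooth x₀ (x₀ + d) hx₀ hxd
    have h2 := hsc (x₀ + d) x₀ hxd hx₀
    rw [add_sub_cancel_left] at h1 h2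
    linarith
  have hjensen := dotProduct_mulVec_sum_le hW hWpos hP hPsum G u
  rw [← hZ, hWZ _ (by rw [mulVec_mulVec, hAZ, zero_mulVec]), dotProduct_comm] at hjensen
  have hupper : σ * ∑ i, P i * ((G i *ᵥ u) ⬝ᵥ W *ᵥ (G i *ᵥ u)) ≤ u ⬝ᵥ Z *ᵥ u := by
    rw [hZ, dotProduct_sum_smul_mulVec, Finset.mul_sum]
    refine Finset.sum_le_sum fun i _ => ?_
    rw [mul_left_comm]
    refine mul_le_mul_of_nonneg_left ?_ (hP i)
    rw [← mulVec_dotProduct_mulVec_mulVec (hG i) (hGM i) u]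
    exact hquad _ (by rw [mulVec_mulVec, hAG, zero_mulVec])
  have hσ1 : σ ≤ 1 := le_of_mul_le_mul_right
    (by linarith [mul_le_mul_of_nonneg_left hjensen hσ.le]) hu
  have hν1 : 1 ≤ ν := le_of_mul_le_mul_right (by linarith [hν u]) hu
  exact hσ1.trans hν1

end SketchDescent

/-- Conditioning on the first `k` samples of an i.i.d. history of length `k + 1`. -/
theorem sum_prod_mul_succ {N k : ℕ} (P : Fin N → ℝ) (F : (Fin (k + 1) → Fin N) → ℝ) :
    ∑ ω, (∏ j, P (ω j)) * F ω =
      ∑ ω : Fin k → Fin N, (∏ j, P (ω j)) *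
        ∑ i, P i * F (Fin.snoc (α := fun _ => Fin N) ω i) := by
  rw [← (Fin.snocEquiv fun _ : Fin (k + 1) => Fin N).sum_comp, Fintype.sum_prod_type_right]
  refine Finset.sum_congr rfl fun ω _ => ?_
  rw [Finset.mul_sum]
  refine Finset.sum_congr rfl fun i _ => ?_
  simp [Fin.snocEquiv, Fin.prod_univ_castSucc, mul_assoc]

/-- accelerated RSD in the smooth strongly convex case:
`E[‖v^k − x*‖²_{Z†} + (2/σ_Z)(f(x^k) − f*)] ≤ (1 − √(σ_Z/ν))^k (‖x⁰ − x*‖²_{Z†} + (2/σ_Z)(f(x⁰) − f*))`. -/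
theorem stmt16 {m n N : ℕ} (A : Matrix (Fin m) (Fin n) ℝ) (b : Fin m → ℝ)
    (x0 : Fin n → ℝ) (hx0 : A.mulVec x0 = b)
    (M : Matrix (Fin n) (Fin n) ℝ) (hM : M.PosSemidef)
    (hMpd : ∀ u : Fin n → ℝ, A.mulVec u = 0 → u ≠ 0 → 0 < u ⬝ᵥ M.mulVec u)
    (f : (Fin n → ℝ) → ℝ) (hdiff : Differentiable ℝ f)
    (hsmooth : ∀ x y : Fin n → ℝ, A.mulVec x = b → A.mulVec y = b →
      f y ≤ f x + gradv f x ⬝ᵥ (y - x) + (1 / 2) * ((y - x) ⬝ᵥ M.mulVec (y - x)))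
    (p : Fin N → ℕ) (S : ∀ i : Fin N, Matrix (Fin n) (Fin (p i)) ℝ)
    (P : Fin N → ℝ) (hP : ∀ i, 0 ≤ P i) (hPsum : ∑ i, P i = 1)
    (Z : Matrix (Fin n) (Fin n) ℝ) (hZ : Z = ∑ i, P i • Zmat A M (S i))
    (hpd : ∀ u : Fin n → ℝ, A.mulVec u = 0 → u ≠ 0 → 0 < u ⬝ᵥ Z.mulVec u)
    (σZ : ℝ) (hσ : 0 < σZ)
    (hsc : ∀ x y : Fin n → ℝ, A.mulVec x = b → A.mulVec y = b →
      f x ≥ f y + gradv f y ⬝ᵥ (x - y) +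
        (σZ / 2) * ((x - y) ⬝ᵥ (mpinv Z).mulVec (x - y)))
    -- `ν ≥ ν_max`
    (ν : ℝ) (hν0 : 0 < ν)
    (hν : ∀ u : Fin n → ℝ, A.mulVec u = 0 → u ≠ 0 →
      (∑ i, P i * ((Zmat A M (S i)).mulVec u ⬝ᵥ
          (mpinv Z).mulVec ((Zmat A M (S i)).mulVec u))) ≤ ν * (u ⬝ᵥ Z.mulVec u))
    -- the parameters
    (γ α β : ℝ) (hγ : γ = 1 / Real.sqrt (σZ * ν))
    (hαdef : α = γ * σZ / (1 + γ * σZ)) (hβdef : β = 1 - γ * σZ)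
    -- the A-RSD iterates, indexed by the history of i.i.d. sketch samples
    (X V Y : ∀ k : ℕ, (Fin k → Fin N) → (Fin n → ℝ))
    (hX0 : ∀ ω : Fin 0 → Fin N, X 0 ω = x0) (hV0 : ∀ ω : Fin 0 → Fin N, V 0 ω = x0)
    (hY : ∀ (k : ℕ) (ω : Fin k → Fin N), Y k ω = α • V k ω + (1 - α) • X k ω)
    (hXstep : ∀ (k : ℕ) (ω : Fin (k + 1) → Fin N),
      X (k + 1) ω = Y k (fun j => ω j.castSucc) -
        (Zmat A M (S (ω (Fin.last k)))).mulVec (gradv f (Y k (fun j => ω j.castSucc))))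
    (hVstep : ∀ (k : ℕ) (ω : Fin (k + 1) → Fin N),
      V (k + 1) ω = β • V k (fun j => ω j.castSucc) +
        (1 - β) • Y k (fun j => ω j.castSucc) -
        γ • (Zmat A M (S (ω (Fin.last k)))).mulVec
          (gradv f (Y k (fun j => ω j.castSucc))))
    -- a minimizer and the optimal value
    (fstar : ℝ) (hfs : ∀ x : Fin n → ℝ, A.mulVec x = b → fstar ≤ f x)
    (xs : Fin n → ℝ) (hxs : A.mulVec xs = b) (hfxs : f xs = fstar)
    (k : ℕ) :
    (∑ ω : Fin k → Fin N, (∏ j, P (ω j)) *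
        ((V k ω - xs) ⬝ᵥ (mpinv Z).mulVec (V k ω - xs) +
          2 / σZ * (f (X k ω) - fstar))) ≤
      (1 - Real.sqrt (σZ / ν)) ^ k *
        ((x0 - xs) ⬝ᵥ (mpinv Z).mulVec (x0 - xs) + 2 / σZ * (f x0 - fstar)) := by
  have hMt : Mᵀ = M := by simpa using hM.isHermitian.eq
  set G := fun i => Zmat A M (S i)
  have hG : ∀ i, (G i)ᵀ = G i := fun i => Zmat_transpose A (S i) hMt
  have hGM : ∀ i, G i * M * G i = G i := fun i => Zmat_mul_mul_Zmat A (S i)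
  have hAG : ∀ i, A * G i = 0 := fun i => mul_Zmat_eq_zero A (S i)
  have hZpsd : Z.PosSemidef := by
    rw [hZ]
    exact posSemidef_sum _ fun i _ => (Zmat_posSemidef A (S i) hM).smul (hP i)
  have hZt : Zᵀ = Z := by simpa using hZpsd.isHermitian.eq
  have hAZ : A * Z = 0 := by
    rw [hZ, Matrix.mul_sum]
    exact Finset.sum_eq_zero fun i _ => by rw [Matrix.mul_smul, hAG i, smul_zero]
  have hW := mpinv_transpose_eq_self hZt
  have hWpos : ∀ a, 0 ≤ a ⬝ᵥ mpinv Z *ᵥ a := fun a => by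
    simpa using (mpinv_posSemidef hZpsd).dotProduct_mulVec_nonneg a
  have hWZ : ∀ w, A *ᵥ w = 0 → ∀ u, w ⬝ᵥ mpinv Z *ᵥ (Z *ᵥ u) = w ⬝ᵥ u := fun w hw u =>
    dotProduct_mpinv_mulVec hZt hAZ hpd hw u
  have hνg : ∀ g, ∑ i, P i * ((G i *ᵥ g) ⬝ᵥ mpinv Z *ᵥ (G i *ᵥ g)) ≤ ν * (g ⬝ᵥ Z *ᵥ g) := by
    intro g
    have hGu : ∀ i, G i *ᵥ ((mpinv Z * Z) *ᵥ g) = G i *ᵥ g := fun i => by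
      rw [mulVec_mulVec, mul_mpinv_mul_of_mul_eq_zero hZt hAZ hpd (hG i) (hAG i)]
    have hZu : Z *ᵥ ((mpinv Z * Z) *ᵥ g) = Z *ᵥ g := by
      rw [mulVec_mulVec, ← Matrix.mul_assoc, (isPenrose_mpinv Z).1]
    have huZ : ((mpinv Z * Z) *ᵥ g) ⬝ᵥ Z *ᵥ g = g ⬝ᵥ Z *ᵥ g := by
      rw [dotProduct_mulVec_comm_of_transpose_eq hZt, hZu]
    by_cases hu : (mpinv Z * Z) *ᵥ g = 0
    · have hG0 : ∀ i, G i *ᵥ g = 0 := fun i => by rw [← hGu i, hu, mulVec_zero]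
      have hZ0 : Z *ᵥ g = 0 := by rw [← hZu, hu, mulVec_zero]
      simp [hG0, hZ0]
    · have h := hν _ (by rw [mulVec_mulVec, mul_mpinv_mul_eq_zero hZt hAZ, zero_mulVec]) hu
      rw [hZu, huZ] at h
      simpa only [← hGu] using h
  have hXG : ∀ k (ω : Fin (k + 1) → Fin N), X (k + 1) ω = Y k (fun j => ω j.castSucc) -
      G (ω (Fin.last k)) *ᵥ gradv f (Y k (fun j => ω j.castSucc)) := hXstep
  have hVG : ∀ k (ω : Fin (k + 1) → Fin N), V (k + 1) ω = β • V k (fun j => ω j.castSucc) +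
      (1 - β) • Y k (fun j => ω j.castSucc) -
        γ • (G (ω (Fin.last k)) *ᵥ gradv f (Y k (fun j => ω j.castSucc))) := hVstep
  have hfeas : ∀ k (ω : Fin k → Fin N), A *ᵥ X k ω = b ∧ A *ᵥ V k ω = b := by
    intro k
    induction k with
    | zero => exact fun ω => by rw [hX0, hV0]; exact ⟨hx0, hx0⟩
    | succ k ih =>
      intro ω
      obtain ⟨h1, h2⟩ := ih fun j => ω j.castSucc
      have hYb : A *ᵥ Y k (fun j => ω j.castSucc) = b := by
        rw [hY, mulVec_add, mulVec_smul, mulVec_smul, h1, h2, ← add_smul, add_sub_cancel, one_smul]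
      have hAGv : ∀ i u, A *ᵥ (G i *ᵥ u) = 0 := fun i u => by
        rw [mulVec_mulVec, hAG, zero_mulVec]
      constructor
      · rw [hXG, mulVec_sub, hYb, hAGv, sub_zero]
      · rw [hVG, mulVec_sub, mulVec_add, mulVec_smul, mulVec_smul, mulVec_smul, hYb, h2, hAGv,
          smul_zero, sub_zero, ← add_smul, add_sub_cancel, one_smul]
  by_cases hker : ∀ u, A *ᵥ u = 0 → u = 0
  · have heq : ∀ x, A *ᵥ x = b → x = xs := fun x hx =>
      sub_eq_zero.1 (hker _ (by rw [mulVec_sub, hx, hxs, sub_self]))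
    have hXe : ∀ ω, X k ω = xs := fun ω => heq _ (hfeas k ω).1
    have hVe : ∀ ω, V k ω = xs := fun ω => heq _ (hfeas k ω).2
    simp [hXe, hVe, heq x0 hx0, hfxs]
  push Not at hker
  obtain ⟨u, hu, hu0⟩ := hker
  have hσν : σZ ≤ ν := strongConvexity_le_of_ker_ne_bot hG hGM hAG hsmooth hP hPsum hZ hW hWpos
    hAZ hWZ hσ hsc hνg hx0 (hpd u hu hu0)
  have hγ0 : 0 < γ := by rw [hγ]; positivity
  have hγ2 : γ ^ 2 * ν = 1 / σZ := by
    rw [hγ, div_pow, Real.sq_sqrt (by positivity)]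
    field_simp
  have hβ : β = 1 - Real.sqrt (σZ / ν) := by
    have h : γ * σZ = Real.sqrt (σZ / ν) := by
      rw [hγ, Real.sqrt_div hσ.le, Real.sqrt_mul hσ.le]
      have hs := Real.sqrt_pos.2 hσ
      have hn := Real.sqrt_pos.2 hν0
      field_simp
      exact (Real.sq_sqrt hσ.le).symm
    rw [hβdef, h]
  have hβ0 : 0 ≤ β := by
    rw [hβ, sub_nonneg, Real.sqrt_le_one, div_le_one hν0]
    exact hσν
  rw [← hβ]
  induction k with
  | zero => simp [hX0, hV0]
  | succ k ih =>
    rw [sum_prod_mul_succ]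
    calc _ ≤ ∑ ω : Fin k → Fin N, (∏ j, P (ω j)) * (β * ((V k ω - xs) ⬝ᵥ mpinv Z *ᵥ (V k ω - xs) +
          2 / σZ * (f (X k ω) - fstar))) := by
          refine Finset.sum_le_sum fun ω _ => mul_le_mul_of_nonneg_left ?_
            (Finset.prod_nonneg fun j _ => hP _)
          have h := accelerated_step_le hG hGM hAG hsmooth hP hPsum hZ hW hWpos hWZ hσ hsc hνg
            hγ0 hγ2 hαdef hβdef hβ0 (hfeas k ω).1 (hfeas k ω).2 hxs (hY k ω)
          rw [hfxs] at h
          simpa only [hXG, hVG, Fin.snoc_castSucc, Fin.snoc_last] using h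
      _ = β * ∑ ω : Fin k → Fin N, (∏ j, P (ω j)) * ((V k ω - xs) ⬝ᵥ mpinv Z *ᵥ (V k ω - xs) +
          2 / σZ * (f (X k ω) - fstar)) := by
          rw [Finset.mul_sum]
          exact Finset.sum_congr rfl fun ω _ => mul_left_comm _ _ _
      _ ≤ _ := by
          rw [pow_succ', mul_assoc]
          exact mul_le_mul_of_nonneg_left ih hβ0
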